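/- Let h ∈ (0,1) and let σ be a behavior strategy in the POMDP with stage duration h, G_h. Then there exists a behavior strategy σ̂ in the base POMDP G_1 such that R(σ, h) = R(σ̂, 1), i.e., the expected long-run average payoff of σ in G_h equals the expected long-run average payoff of σ̂ in G_1. -/

import Mathlib

open Filter

/-- A POMDP (data only): deterministic signal map `f`, stage payoff `g`,
transition kernel `P`, and initial distribution `p1`. -/
structure POMDP (Ω A S : Type*) where
  f : Ω → S
  g : Ω → A → ℝ
  P : Ω → A → Ω → ℝ
  p1 : Ω → ℝ

/-- A history `(s₁, a₁, …, a_{t-1}, s_t)`, encoded as the reversed list of past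
(signal, action) pairs together with the current signal. -/
abbrev Hist (S A : Type*) := List (S × A) × S

/-- A behavior strategy (data only): a mixed action for every finite history. -/
abbrev Strategy (S A : Type*) := Hist S A → A → ℝ

/-- `σ η ∈ Δ(A)` for every history `η`. -/
def IsStrategy {S A : Type*} [Fintype A] (σ : Strategy S A) : Prop :=
  (∀ η a, 0 ≤ σ η a) ∧ ∀ η, ∑ a, σ η a = 1

namespace POMDP

variable {Ω A S : Type*} [Fintype Ω] [Fintype A]

/-- `P ω a ∈ Δ(Ω)` for every `(ω, a)`, and `p1 ∈ Δ(Ω)`. -/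
def IsValid (M : POMDP Ω A S) : Prop :=
  (∀ ω a ω', 0 ≤ M.P ω a ω') ∧ (∀ ω a, ∑ ω', M.P ω a ω' = 1) ∧
    (∀ ω, 0 ≤ M.p1 ω) ∧ ∑ ω, M.p1 ω = 1

/-- The observable history determined by a reversed past trajectory and the
current state. -/
def obs (M : POMDP Ω A S) (rev : List (Ω × A)) (ω : Ω) : Hist S A :=
  (rev.map fun p => (M.f p.1, p.2), M.f ω)

/-- Probability of a finite trajectory `(ω₁, a₁, …, ω_t, a_t)` under a strategy,
the trajectory being given in reverse order (the head of the list is the most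
recent (state, action) pair). -/
def trajP (M : POMDP Ω A S) (σ : Strategy S A) : List (Ω × A) → ℝ
  | [] => 1
  | (ω, a) :: rest =>
      (match rest with
        | [] => M.p1 ω
        | (ω', a') :: _ => M.P ω' a' ω) *
        σ (M.obs rest ω) a * trajP M σ rest

/-- The expected stage-`(n+1)` payoff `E_σ[g(ω_{n+1}, a_{n+1})]`. -/
noncomputable def stageE (M : POMDP Ω A S) (σ : Strategy S A) (n : ℕ) : ℝ :=
  ∑ tr : Fin (n + 1) → Ω × A, trajP M σ (List.ofFn tr) * M.g (tr 0).1 (tr 0).2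

/-- The expected long-run average payoff
`R(σ) = liminf_T E_σ[(1/T) ∑_{i=1}^T g(ω_i, a_i)]`. -/
noncomputable def R (M : POMDP Ω A S) (σ : Strategy S A) : ℝ :=
  liminf (fun T : ℕ => (1 / (T : ℝ)) * ∑ n ∈ Finset.range T, stageE M σ n) atTop

/-- The POMDP `G_h` with stage duration `h`:
`P_h(⬝|ω,a) = h·P(⬝|ω,a) + (1-h)·δ_ω`. -/
def dur [DecidableEq Ω] (M : POMDP Ω A S) (h : ℝ) : POMDP Ω A S :=
  { M with P := fun ω a ω' => h * M.P ω a ω' + (1 - h) * (if ω' = ω then 1 else 0) }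

/-- The asymptotic value `V(h) = sup_σ R(σ, h)` of `G_h`. -/
noncomputable def V [DecidableEq Ω] (M : POMDP Ω A S) (h : ℝ) : ℝ :=
  sSup {r | ∃ σ : Strategy S A, IsStrategy σ ∧ r = (M.dur h).R σ}

end POMDP

section Sequences

/-- The sum of a nonnegative solution of `a (n + 1) = (1 - h) * a n + b n`. -/
lemma hasSum_of_affine_rec {h B : ℝ} (hh : 0 < h) {a b : ℕ → ℝ} (ha : ∀ n, 0 ≤ a n)
    (hb : ∀ n, 0 ≤ b n) (hB : HasSum b B) (hrec : ∀ n, a (n + 1) = (1 - h) * a n + b n) :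
    HasSum a ((a 0 + B) / h) := by
  have key : ∀ n, h * ∑ i ∈ Finset.range n, a i + a n = a 0 + ∑ i ∈ Finset.range n, b i := by
    intro n
    induction n with
    | zero => simp
    | succ n ih => rw [Finset.sum_range_succ, Finset.sum_range_succ, hrec]; linarith
  have hle : ∀ n, ∑ i ∈ Finset.range n, a i ≤ (a 0 + B) / h := by
    intro n
    rw [le_div_iff₀ hh]
    have := sum_le_hasSum (Finset.range n) (fun i _ => hb i) hB
    linarith [key n, ha n]
  have hs : Summable a := summable_of_sum_range_le ha hle
  rw [hasSum_iff_tendsto_nat_of_nonneg ha]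
  have h1 := ((hB.tendsto_sum_nat.const_add (a 0)).sub hs.tendsto_atTop_zero).div_const h
  rw [sub_zero] at h1
  refine h1.congr fun n => ?_
  rw [div_eq_iff hh.ne', ← key n]
  ring

/-- The probability that `n` independent Bernoulli variables of parameter `h` sum to `k`. -/
noncomputable def binomialWeight (h : ℝ) : ℕ → ℕ → ℝ
  | 0, 0 => 1
  | 0, _ + 1 => 0
  | n + 1, 0 => (1 - h) * binomialWeight h n 0
  | n + 1, k + 1 => (1 - h) * binomialWeight h n (k + 1) + h * binomialWeight h n k

lemma binomialWeight_nonneg {h : ℝ} (h0 : 0 ≤ h) (h1 : h ≤ 1) (n k : ℕ) :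
    0 ≤ binomialWeight h n k := by
  have h2 : 0 ≤ 1 - h := by linarith
  induction n generalizing k with
  | zero => cases k <;> simp [binomialWeight]
  | succ n ih =>
    cases k with
    | zero => exact mul_nonneg h2 (ih _)
    | succ k => exact add_nonneg (mul_nonneg h2 (ih _)) (mul_nonneg h0 (ih _))

lemma binomialWeight_eq_zero {h : ℝ} {n k : ℕ} (hk : n < k) : binomialWeight h n k = 0 := by
  induction n generalizing k with
  | zero =>
    cases k with
    | zero => omega
    | succ k => rfl
  | succ n ih =>
    cases k with
    | zero => omega
    | succ k => simp [binomialWeight, ih (show n < k by omega), ih (show n < k + 1 by omega)]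

lemma sum_binomialWeight_succ (h : ℝ) (n : ℕ) (ψ : ℕ → ℝ) :
    ∑ k ∈ Finset.range (n + 2), binomialWeight h (n + 1) k * ψ k =
      ∑ k ∈ Finset.range (n + 1),
        binomialWeight h n k * (h * ψ (k + 1) + (1 - h) * ψ k) := by
  have h1 : ∑ k ∈ Finset.range (n + 1), binomialWeight h n k * ψ k =
      ∑ k ∈ Finset.range (n + 1), binomialWeight h n (k + 1) * ψ (k + 1) +
        binomialWeight h n 0 * ψ 0 := by
    rw [← Finset.sum_range_succ' (fun k => binomialWeight h n k * ψ k),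
      Finset.sum_range_succ _ (n + 1), binomialWeight_eq_zero (Nat.lt_succ_self n)]
    simp
  calc _ = (1 - h) * (∑ k ∈ Finset.range (n + 1), binomialWeight h n (k + 1) * ψ (k + 1) +
        binomialWeight h n 0 * ψ 0) +
        h * ∑ k ∈ Finset.range (n + 1), binomialWeight h n k * ψ (k + 1) := by
        rw [Finset.sum_range_succ', mul_add, Finset.mul_sum, Finset.mul_sum, add_right_comm,
          ← Finset.sum_add_distrib]
        congr 1
        · exact Finset.sum_congr rfl fun k _ => by simp only [binomialWeight]; ring
        · simp only [binomialWeight]; ring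
    _ = _ := by
        rw [← h1, Finset.mul_sum, Finset.mul_sum, ← Finset.sum_add_distrib]
        exact Finset.sum_congr rfl fun k _ => by ring

lemma sum_binomialWeight (h : ℝ) (n : ℕ) :
    ∑ k ∈ Finset.range (n + 1), binomialWeight h n k = 1 := by
  induction n with
  | zero => simp [binomialWeight]
  | succ n ih =>
    have := sum_binomialWeight_succ h n fun _ => 1
    simpa [ih] using this

lemma sum_binomialWeight_variance (h : ℝ) (n : ℕ) :
    ∑ k ∈ Finset.range (n + 1), binomialWeight h n k * (k - h * n) ^ 2 = n * (h * (1 - h)) := by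
  induction n with
  | zero => simp [binomialWeight]
  | succ n ih =>
    rw [sum_binomialWeight_succ]
    calc _ = ∑ k ∈ Finset.range (n + 1), (binomialWeight h n k * (k - h * n) ^ 2 +
          h * (1 - h) * binomialWeight h n k) :=
          Finset.sum_congr rfl fun k _ => by push_cast; ring
      _ = _ := by
          rw [Finset.sum_add_distrib, ih, ← Finset.mul_sum, sum_binomialWeight]
          push_cast; ring

lemma hasSum_binomialWeight {h : ℝ} (h0 : 0 < h) (h1 : h ≤ 1) (k : ℕ) :
    HasSum (fun n => binomialWeight h n k) (1 / h) := by
  induction k with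
  | zero =>
    have := hasSum_of_affine_rec h0 (fun n => binomialWeight_nonneg h0.le h1 n 0)
      (fun _ => le_rfl) hasSum_zero (fun n => by simp [binomialWeight])
    simpa [binomialWeight] using this
  | succ k ih =>
    have := hasSum_of_affine_rec h0 (fun n => binomialWeight_nonneg h0.le h1 n (k + 1))
      (fun n => mul_nonneg h0.le (binomialWeight_nonneg h0.le h1 n k)) (ih.mul_left h)
      (fun n => by simp [binomialWeight])
    simpa [binomialWeight, h0.ne'] using this

/-- The expected time before `T` spent by the binomial walk at or above level `m`. -/
noncomputable def overshoot (h : ℝ) (m T : ℕ) : ℝ :=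
  ∑ n ∈ Finset.range T, ∑ k ∈ Finset.range (n + 1) with m ≤ k, binomialWeight h n k

lemma mul_overshoot (h : ℝ) (m T : ℕ) :
    h * overshoot h m T =
      ∑ k ∈ Finset.range (T + 1), binomialWeight h T k * ((k - m : ℕ) : ℝ) := by
  induction T with
  | zero => simp [overshoot]
  | succ T ih =>
    rw [sum_binomialWeight_succ, overshoot, Finset.sum_range_succ, mul_add, ← overshoot, ih,
      Finset.sum_filter, Finset.mul_sum, ← Finset.sum_add_distrib]
    refine Finset.sum_congr rfl fun k _ => ?_
    by_cases hk : m ≤ k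
    · rw [if_pos hk, Nat.succ_sub hk]; push_cast; ring
    · rw [if_neg hk, Nat.sub_eq_zero_of_le (by omega : k ≤ m),
        Nat.sub_eq_zero_of_le (by omega : k + 1 ≤ m)]
      simp

lemma overshoot_le {h : ℝ} (h0 : 0 < h) (h1 : h < 1) {m T : ℕ} (hT : 0 < T)
    (hm : h * T ≤ m + 1) : overshoot h m T ≤ (1 + √T) / h := by
  rw [le_div_iff₀' h0, mul_overshoot]
  have hs : 0 < √(T : ℝ) := Real.sqrt_pos.2 (by exact_mod_cast hT)
  have hs2 : √(T : ℝ) ^ 2 = T := Real.sq_sqrt (by positivity)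
  have hpt : ∀ k : ℕ, ((k - m : ℕ) : ℝ) ≤ (1 + √T / 2) + (k - h * T) ^ 2 / (2 * √T) := by
    intro k
    have h2 : (k - h * T : ℝ) ≤ √T / 2 + (k - h * T) ^ 2 / (2 * √T) := by
      have : √(T : ℝ) / 2 + (k - h * T) ^ 2 / (2 * √T) - (k - h * T) =
          (√T - (k - h * T)) ^ 2 / (2 * √T) := by field_simp; ring
      have : 0 ≤ (√(T : ℝ) - (k - h * T)) ^ 2 / (2 * √T) := by positivity
      linarith
    rcases le_total m k with hk | hk
    · rw [Nat.cast_sub hk]; linarith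
    · rw [Nat.sub_eq_zero_of_le hk]; push_cast; positivity
  calc _ ≤ ∑ k ∈ Finset.range (T + 1), ((1 + √T / 2) * binomialWeight h T k +
        (binomialWeight h T k * (k - h * T) ^ 2) / (2 * √T)) := by
        refine Finset.sum_le_sum fun k _ => ?_
        have := mul_le_mul_of_nonneg_left (hpt k) (binomialWeight_nonneg h0.le h1.le T k)
        refine this.trans_eq ?_
        ring
    _ = (1 + √T / 2) + T * (h * (1 - h)) / (2 * √T) := by
        rw [Finset.sum_add_distrib, ← Finset.mul_sum, ← Finset.sum_div, sum_binomialWeight,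
          sum_binomialWeight_variance, mul_one]
    _ ≤ _ := by
        have : T * (h * (1 - h)) / (2 * √T) ≤ √T / 2 := by
          rw [div_le_div_iff₀ (by positivity) two_pos]
          nlinarith [mul_pos h0 (sub_pos.2 h1), sq_nonneg h]
        linarith

/-- Comparison of the sums of a doubly indexed family dominated by binomial weights
along rows and along columns. -/
lemma abs_sum_rows_sub_sum_columns_le {h C : ℝ} (h0 : 0 < h) (h1 : h < 1)
    {v : ℕ → ℕ → ℝ} (hv : ∀ n k, |v n k| ≤ C * binomialWeight h n k) {c : ℕ → ℝ}
    (hc : ∀ k, HasSum (fun n => v n k) (c k)) {m T : ℕ} (hm : m ≤ h * T) :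
    |∑ n ∈ Finset.range T, ∑ k ∈ Finset.range (n + 1), v n k - ∑ k ∈ Finset.range m, c k| ≤
      2 * (C * overshoot h m T) := by
  have hC : 0 ≤ C := by simpa [binomialWeight] using (abs_nonneg _).trans (hv 0 0)
  have split : ∀ w : ℕ → ℕ → ℝ, (∀ n k, n < k → w n k = 0) →
      ∑ n ∈ Finset.range T, ∑ k ∈ Finset.range (n + 1), w n k =
      ∑ k ∈ Finset.range m, ∑ n ∈ Finset.range T, w n k +
      ∑ n ∈ Finset.range T, ∑ k ∈ Finset.range (n + 1) with m ≤ k, w n k := by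
    intro w hw
    rw [Finset.sum_comm (s := Finset.range m), ← Finset.sum_add_distrib]
    refine Finset.sum_congr rfl fun n _ => ?_
    rw [← Finset.sum_filter_add_sum_filter_not (Finset.range (n + 1)) (fun k => m ≤ k), add_comm]
    congr 1
    refine Finset.sum_subset (fun k hk => ?_) fun k hk hk' => hw n k ?_
    · simp at hk ⊢; omega
    · simp at hk hk'; omega
  have hp := split (binomialWeight h) fun n k => binomialWeight_eq_zero
  rw [← overshoot] at hp
  simp only [sum_binomialWeight, Finset.sum_const, Finset.card_range, nsmul_eq_mul, mul_one] at hp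
  rw [split v fun n k hk => by simpa [binomialWeight_eq_zero hk] using hv n k]
  have hhigh : |∑ n ∈ Finset.range T, ∑ k ∈ Finset.range (n + 1) with m ≤ k, v n k| ≤
      C * overshoot h m T := by
    rw [overshoot, Finset.mul_sum]
    refine (Finset.abs_sum_le_sum_abs _ _).trans (Finset.sum_le_sum fun n _ => ?_)
    rw [Finset.mul_sum]
    exact (Finset.abs_sum_le_sum_abs _ _).trans (Finset.sum_le_sum fun k _ => hv n k)
  have htail : ∀ k, |c k - ∑ n ∈ Finset.range T, v n k| ≤
      C * (1 / h - ∑ n ∈ Finset.range T, binomialWeight h n k) := by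
    intro k
    have e1 := (hasSum_nat_add_iff' T).2 (hc k)
    have e2 := ((hasSum_nat_add_iff' T).2 (hasSum_binomialWeight h0 h1.le k)).mul_left C
    rw [abs_le]
    exact ⟨neg_le.1 (hasSum_le (fun n => (neg_le_abs _).trans (hv _ _)) e1.neg e2),
      hasSum_le (fun n => (le_abs_self _).trans (hv _ _)) e1 e2⟩
  have hlow : |∑ k ∈ Finset.range m, (c k - ∑ n ∈ Finset.range T, v n k)| ≤
      C * overshoot h m T := by
    calc _ ≤ ∑ k ∈ Finset.range m, C * (1 / h - ∑ n ∈ Finset.range T, binomialWeight h n k) :=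
          (Finset.abs_sum_le_sum_abs _ _).trans (Finset.sum_le_sum fun k _ => htail k)
      _ = C * (m / h - (T - overshoot h m T)) := by
          rw [← Finset.mul_sum, Finset.sum_sub_distrib, hp]
          simp
          left; rw [div_eq_mul_inv]
      _ ≤ _ := by
          refine mul_le_mul_of_nonneg_left ?_ hC
          have : (m : ℝ) / h ≤ T := by rwa [div_le_iff₀' h0]
          linarith
  rw [Finset.sum_sub_distrib] at hlow
  rw [abs_le] at *
  constructor <;> linarith

lemma liminf_le_of_tendsto_sub {x y : ℕ → ℝ} {C : ℝ} (hx : ∀ n, |x n| ≤ C)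
    (hy : ∀ n, |y n| ≤ C) (hxy : Tendsto (fun n => x n - y n) atTop (nhds 0)) :
    liminf x atTop ≤ liminf y atTop := by
  have bx : IsBoundedUnder (· ≥ ·) atTop x :=
    isBoundedUnder_of ⟨-C, fun n => (abs_le.1 (hx n)).1⟩
  have hcob : IsCoboundedUnder (· ≥ ·) atTop y :=
    (isBoundedUnder_of ⟨C, fun n => (abs_le.1 (hy n)).2⟩ :
      IsBoundedUnder (· ≤ ·) atTop y).isCoboundedUnder_flip
  refine le_of_forall_lt_imp_le_of_dense fun c hc => ?_
  obtain ⟨d, hcd, hd⟩ := exists_between hc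
  refine le_liminf_of_le hcob ?_
  filter_upwards [eventually_lt_of_lt_liminf hd bx,
    hxy.eventually (gt_mem_nhds (sub_pos.2 hcd))] with n h1 h2
  linarith

lemma liminf_eq_of_tendsto_sub {x y : ℕ → ℝ} {C : ℝ} (hx : ∀ n, |x n| ≤ C)
    (hy : ∀ n, |y n| ≤ C) (hxy : Tendsto (fun n => x n - y n) atTop (nhds 0)) :
    liminf x atTop = liminf y atTop :=
  le_antisymm (liminf_le_of_tendsto_sub hx hy hxy)
    (liminf_le_of_tendsto_sub hy hx (by simpa using hxy.neg))

lemma map_floor_mul_atTop {h : ℝ} (h0 : 0 < h) (h1 : h ≤ 1) :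
    map (fun T : ℕ => ⌊h * T⌋₊) atTop = atTop := by
  refine map_atTop_eq_of_gc (fun c => ⌈((c : ℝ) + 1) / h⌉₊ - 1) 0
    (fun a b hab => Nat.floor_mono (by gcongr)) (fun T c _ => ?_) fun c _ => ?_
  · rw [← Nat.lt_add_one_iff, Nat.floor_lt (by positivity), Nat.le_sub_one_iff_lt
      (Nat.ceil_pos.2 (by positivity)), Nat.lt_ceil, lt_div_iff₀' h0]
    push_cast
    rfl
  · refine Nat.le_floor ?_
    have hpos : 1 ≤ ⌈((c : ℝ) + 1) / h⌉₊ := Nat.ceil_pos.2 (by positivity)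
    have hle := (div_le_iff₀' h0).1 (Nat.le_ceil (((c : ℝ) + 1) / h))
    rw [Nat.cast_sub hpos]
    push_cast
    linarith

lemma abs_average_le {a : ℕ → ℝ} {C : ℝ} (ha : ∀ n, |a n| ≤ C) (T : ℕ) :
    |(1 / (T : ℝ)) * ∑ n ∈ Finset.range T, a n| ≤ C := by
  have hC : 0 ≤ C := (abs_nonneg _).trans (ha 0)
  rcases T.eq_zero_or_pos with rfl | hT
  · simpa using hC
  have hT' : (0 : ℝ) < T := by exact_mod_cast hT
  rw [abs_mul, abs_of_pos (by positivity), one_div, inv_mul_le_iff₀ hT']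
  refine (Finset.abs_sum_le_sum_abs _ _).trans ((Finset.sum_le_sum fun n _ => ha n).trans ?_)
  simp

/-- If the columns of a family dominated by binomial weights of parameter `h` sum to `c k / h`,
then its row sums and `c` have the same lower long-run average. -/
lemma liminf_average_rows_eq {h C : ℝ} (h0 : 0 < h) (h1 : h < 1)
    {v : ℕ → ℕ → ℝ} (hv : ∀ n k, |v n k| ≤ C * binomialWeight h n k) {c : ℕ → ℝ}
    (hc : ∀ k, HasSum (fun n => v n k) (c k / h)) :
    liminf (fun T : ℕ => (1 / (T : ℝ)) *
        ∑ n ∈ Finset.range T, ∑ k ∈ Finset.range (n + 1), v n k) atTop =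
      liminf (fun T : ℕ => (1 / (T : ℝ)) * ∑ k ∈ Finset.range T, c k) atTop := by
  have hC : 0 ≤ C := by simpa [binomialWeight] using (abs_nonneg _).trans (hv 0 0)
  have hrow : ∀ n, |∑ k ∈ Finset.range (n + 1), v n k| ≤ C := fun n => by
    refine (Finset.abs_sum_le_sum_abs _ _).trans ((Finset.sum_le_sum fun k _ => hv n k).trans ?_)
    rw [← Finset.mul_sum, sum_binomialWeight, mul_one]
  have hcol : ∀ k, |c k| ≤ C := fun k => by
    have e2 := (hasSum_binomialWeight h0 h1.le k).mul_left C
    have : |c k / h| ≤ C * (1 / h) := abs_le.2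
      ⟨neg_le.1 (hasSum_le (fun n => (neg_le_abs _).trans (hv _ _)) (hc k).neg e2),
      hasSum_le (fun n => (le_abs_self _).trans (hv _ _)) (hc k) e2⟩
    rw [abs_div, abs_of_pos h0, mul_one_div] at this
    exact (div_le_div_iff_of_pos_right h0).1 this
  have hresc : liminf (fun T : ℕ => (1 / (T : ℝ)) * ∑ k ∈ Finset.range T, c k) atTop =
      liminf (fun T : ℕ => (1 / (⌊h * T⌋₊ : ℝ)) * ∑ k ∈ Finset.range ⌊h * T⌋₊, c k) atTop := by
    conv_lhs => rw [← map_floor_mul_atTop h0 h1.le]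
    rfl
  rw [hresc]
  refine liminf_eq_of_tendsto_sub (abs_average_le hrow) (fun T => abs_average_le hcol _) ?_
  have hlim : Tendsto (fun T : ℕ => 2 * C / h * (1 / (T : ℝ) + 1 / √T) + C / h * (1 / (T : ℝ)))
      atTop (nhds 0) := by
    have e1 : Tendsto (fun T : ℕ => 1 / (T : ℝ)) atTop (nhds 0) :=
      tendsto_one_div_atTop_nhds_zero_nat
    have e2 : Tendsto (fun T : ℕ => 1 / √(T : ℝ)) atTop (nhds 0) := by
      simp only [one_div]
      exact (Real.tendsto_sqrt_atTop.comp tendsto_natCast_atTop_atTop).inv_tendsto_atTop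
    simpa using ((e1.add e2).const_mul (2 * C / h)).add (e1.const_mul (C / h))
  refine squeeze_zero_norm' ?_ hlim
  filter_upwards [eventually_gt_atTop 0] with T hT
  have hT' : (0 : ℝ) < T := by exact_mod_cast hT
  have hs : 0 < √(T : ℝ) := Real.sqrt_pos.2 hT'
  set m := ⌊h * T⌋₊ with hm
  have hm1 : (m : ℝ) ≤ h * T := Nat.floor_le (by positivity)
  have hm2 : h * T ≤ m + 1 := (Nat.lt_floor_add_one _).le
  have hmain := abs_sum_rows_sub_sum_columns_le h0 h1 hv hc hm1
  have hover := overshoot_le h0 h1 hT hm2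
  set X := ∑ n ∈ Finset.range T, ∑ k ∈ Finset.range (n + 1), v n k
  set Y := ∑ k ∈ Finset.range m, c k with hY
  rw [← Finset.sum_div, ← hY] at hmain
  have hfirst : |1 / (T : ℝ) * X - 1 / (T : ℝ) * (Y / h)| ≤
      2 * C / h * (1 / (T : ℝ) + 1 / √T) := by
    rw [← mul_sub, abs_mul, abs_of_pos (by positivity : 0 < 1 / (T : ℝ))]
    calc _ ≤ 1 / (T : ℝ) * (2 * (C * ((1 + √T) / h))) := by
          gcongr; exact hmain.trans (by gcongr)
      _ = _ := by
          have : (1 : ℝ) / √T = √T / T := by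
            rw [div_eq_div_iff hs.ne' hT'.ne', one_mul, Real.mul_self_sqrt hT'.le]
          rw [this]; field_simp
  have hYm : |1 / (m : ℝ) * Y| ≤ C := abs_average_le hcol m
  have hsecond : |1 / (T : ℝ) * (Y / h) - 1 / (m : ℝ) * Y| ≤ C / h * (1 / (T : ℝ)) := by
    have e : 1 / (T : ℝ) * (Y / h) - 1 / (m : ℝ) * Y =
        -((h * T - m) / (h * T) * (1 / (m : ℝ) * Y)) := by
      rcases m.eq_zero_or_pos with h3 | h3
      · simp [hY, h3]
      · have : (0 : ℝ) < m := by exact_mod_cast h3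
        field_simp
        ring
    rw [e, abs_neg, abs_mul, abs_of_nonneg (div_nonneg (by linarith) (by positivity))]
    calc _ ≤ 1 / (h * T) * C := by
          gcongr
          linarith
      _ = _ := by field_simp
  rw [Real.norm_eq_abs]
  exact (abs_sub_le _ (1 / (T : ℝ) * (Y / h)) _).trans (add_le_add hfirst hsecond)

end Sequences

section Lists

lemma sum_ofFn_succ {X : Type*} [Fintype X] (n : ℕ) (F : List X → ℝ) :
    ∑ b : Fin (n + 1) → X, F (List.ofFn b) =
      ∑ b : Fin n → X, ∑ x, F (x :: List.ofFn b) := by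
  rw [← (Fin.consEquiv fun _ => X).sum_comp, Fintype.sum_prod_type, Finset.sum_comm]
  simp [Fin.consEquiv, List.ofFn_succ]

end Lists

section Mimic

variable {S A : Type*} [Fintype A]

/-- The stage at which the current state does not change, acting on functions of the past:
the next past is obtained by adding `(s, a)` with `a` drawn according to `σ`. -/
noncomputable def stay (σ : Strategy S A) (h : ℝ) (s : S) :
    (List (S × A) → ℝ) →ₗ[ℝ] (List (S × A) → ℝ) where
  toFun φ l := (1 - h) * ∑ a, σ (l, s) a * φ ((s, a) :: l)
  map_add' φ ψ := by
    ext l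
    simp only [Pi.add_apply, mul_add, Finset.sum_add_distrib]
  map_smul' c φ := by
    ext l
    simp only [Pi.smul_apply, smul_eq_mul, RingHom.id_apply, Finset.mul_sum]
    exact Finset.sum_congr rfl fun a _ => by ring

/-- The stage at which the action of `x` is played and the state is then redrawn, acting on
functions of the past. -/
noncomputable def jump (σ : Strategy S A) (h : ℝ) (x : S × A) :
    (List (S × A) → ℝ) →ₗ[ℝ] (List (S × A) → ℝ) where
  toFun φ l := h * σ (l, x.1) x.2 * φ (x :: l)
  map_add' φ ψ := by
    ext l
    simp only [Pi.add_apply, mul_add]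
  map_smul' c φ := by
    ext l
    simp only [Pi.smul_apply, smul_eq_mul, RingHom.id_apply]
    ring

/-- The measure on pasts of length `n` of the game of stage duration `h` whose subsequence of
stages after which the state is redrawn is `ρ`, the current signal being `s`. The state
transition probabilities are left out. -/
noncomputable def pastMeasure (σ : Strategy S A) (h : ℝ) :
    ℕ → List (S × A) → S → (List (S × A) → ℝ) →ₗ[ℝ] ℝ
  | 0, [], _ => LinearMap.proj []
  | 0, _ :: _, _ => 0
  | n + 1, [], s => pastMeasure σ h n [] s ∘ₗ stay σ h s
  | n + 1, x :: ρ, s =>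
      pastMeasure σ h n (x :: ρ) s ∘ₗ stay σ h s + pastMeasure σ h n ρ x.1 ∘ₗ jump σ h x

/-- The total weight of pasts compatible with `ρ` and `s` for which `a` is the last action played
before the state is redrawn. -/
noncomputable def jumpWeight (σ : Strategy S A) (h : ℝ) (ρ : List (S × A)) (s : S) (a : A) : ℝ :=
  ∑' n, pastMeasure σ h n ρ s (jump σ h (s, a) 1)

/-- The total weight of `ρ`. -/
noncomputable def totalWeight (σ : Strategy S A) (h : ℝ) : List (S × A) → ℝ
  | [] => 1
  | x :: ρ => jumpWeight σ h ρ x.1 x.2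

open Classical in
/-- The strategy in the base game which plays the last action played by `σ` before the state is
redrawn. -/
noncomputable def mimic (σ : Strategy S A) (h : ℝ) : Strategy S A := fun η a =>
  if totalWeight σ h η.1 = 0 then σ η a else jumpWeight σ h η.1 η.2 a / totalWeight σ h η.1

variable {σ : Strategy S A} {h : ℝ}

lemma stay_nonneg (hσ : IsStrategy σ) (h1 : h ≤ 1) (s : S) {φ : List (S × A) → ℝ} (hφ : 0 ≤ φ) :
    0 ≤ stay σ h s φ := fun _ =>
  mul_nonneg (sub_nonneg.2 h1) (Finset.sum_nonneg fun a _ => mul_nonneg (hσ.1 _ a) (hφ _))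

lemma jump_nonneg (hσ : IsStrategy σ) (h0 : 0 ≤ h) (x : S × A) {φ : List (S × A) → ℝ}
    (hφ : 0 ≤ φ) : 0 ≤ jump σ h x φ := fun _ =>
  mul_nonneg (mul_nonneg h0 (hσ.1 _ _)) (hφ _)

lemma stay_one (hσ : IsStrategy σ) (s : S) : stay σ h s 1 = (1 - h) • 1 := by
  ext l
  simp [stay, hσ.2]

lemma sum_jump_one (hσ : IsStrategy σ) (s : S) : ∑ a, jump σ h (s, a) 1 = h • 1 := by
  ext l
  simp [jump, ← Finset.mul_sum, hσ.2]

lemma pastMeasure_nonneg (hσ : IsStrategy σ) (h0 : 0 ≤ h) (h1 : h ≤ 1) (n : ℕ)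
    (ρ : List (S × A)) (s : S) {φ : List (S × A) → ℝ} (hφ : 0 ≤ φ) :
    0 ≤ pastMeasure σ h n ρ s φ := by
  induction n generalizing ρ s φ with
  | zero =>
    cases ρ with
    | nil => exact hφ []
    | cons x ρ => exact le_rfl
  | succ n ih =>
    cases ρ with
    | nil => exact ih _ _ (stay_nonneg hσ h1 s hφ)
    | cons x ρ =>
      exact add_nonneg (ih _ _ (stay_nonneg hσ h1 s hφ)) (ih _ _ (jump_nonneg hσ h0 x hφ))

lemma abs_pastMeasure_le (hσ : IsStrategy σ) (h0 : 0 ≤ h) (h1 : h ≤ 1) (n : ℕ)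
    (ρ : List (S × A)) (s : S) {φ : List (S × A) → ℝ} {C : ℝ} (hφ : ∀ l, |φ l| ≤ C) :
    |pastMeasure σ h n ρ s φ| ≤ C * pastMeasure σ h n ρ s 1 := by
  have e1 := pastMeasure_nonneg hσ h0 h1 n ρ s (φ := C • 1 - φ) fun l => by
    simpa using (abs_le.1 (hφ l)).2
  have e2 := pastMeasure_nonneg hσ h0 h1 n ρ s (φ := C • 1 + φ) fun l => by
    simpa using neg_le_iff_add_nonneg'.1 (abs_le.1 (hφ l)).1
  rw [map_sub, map_smul, smul_eq_mul] at e1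
  rw [map_add, map_smul, smul_eq_mul] at e2
  rw [abs_le]
  constructor <;> linarith

lemma sum_pastMeasure_jump (hσ : IsStrategy σ) (n : ℕ) (ρ : List (S × A)) (s : S) :
    ∑ a, pastMeasure σ h n ρ s (jump σ h (s, a) 1) = h * pastMeasure σ h n ρ s 1 := by
  rw [← map_sum, sum_jump_one hσ, map_smul, smul_eq_mul]

lemma summable_pastMeasure_jump (hσ : IsStrategy σ) (h0 : 0 ≤ h) (h1 : h ≤ 1)
    {ρ : List (S × A)} {s : S} (hs : Summable fun n => pastMeasure σ h n ρ s 1) (a : A) :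
    Summable fun n => pastMeasure σ h n ρ s (jump σ h (s, a) 1) := by
  have hn : ∀ n a, 0 ≤ pastMeasure σ h n ρ s (jump σ h (s, a) 1) := fun n a =>
    pastMeasure_nonneg hσ h0 h1 n ρ s (jump_nonneg hσ h0 _ zero_le_one)
  refine Summable.of_nonneg_of_le (fun n => hn n a) (fun n => ?_) (hs.mul_left h)
  rw [← sum_pastMeasure_jump hσ]
  exact Finset.single_le_sum (f := fun a => pastMeasure σ h n ρ s (jump σ h (s, a) 1))
    (fun a _ => hn n a) (Finset.mem_univ a)

lemma hasSum_pastMeasure_one (hσ : IsStrategy σ) (h0 : 0 < h) (h1 : h ≤ 1)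
    (ρ : List (S × A)) (s : S) :
    HasSum (fun n => pastMeasure σ h n ρ s 1) (totalWeight σ h ρ / h) := by
  induction ρ generalizing s with
  | nil =>
    have := hasSum_of_affine_rec h0
      (fun n => pastMeasure_nonneg hσ h0.le h1 n [] s zero_le_one)
      (fun _ => le_rfl) hasSum_zero (fun n => by
        simp only [pastMeasure, LinearMap.comp_apply, stay_one hσ, map_smul, smul_eq_mul, add_zero])
    simpa [pastMeasure, totalWeight] using this
  | cons x ρ ih =>
    have := hasSum_of_affine_rec h0
      (fun n => pastMeasure_nonneg hσ h0.le h1 n (x :: ρ) s zero_le_one)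
      (fun n => pastMeasure_nonneg hσ h0.le h1 n ρ x.1 (jump_nonneg hσ h0.le x zero_le_one))
      (summable_pastMeasure_jump hσ h0.le h1 (ih x.1).summable x.2).hasSum (fun n => by
        simp only [pastMeasure, LinearMap.add_apply, LinearMap.comp_apply, stay_one hσ, map_smul,
          smul_eq_mul])
    simpa [pastMeasure, totalWeight, jumpWeight] using this

lemma hasSum_jumpWeight (hσ : IsStrategy σ) (h0 : 0 < h) (h1 : h ≤ 1)
    (ρ : List (S × A)) (s : S) (a : A) :
    HasSum (fun n => pastMeasure σ h n ρ s (jump σ h (s, a) 1)) (jumpWeight σ h ρ s a) :=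
  (summable_pastMeasure_jump hσ h0.le h1 (hasSum_pastMeasure_one hσ h0 h1 ρ s).summable a).hasSum

lemma jumpWeight_nonneg (hσ : IsStrategy σ) (h0 : 0 < h) (h1 : h ≤ 1)
    (ρ : List (S × A)) (s : S) (a : A) : 0 ≤ jumpWeight σ h ρ s a :=
  tsum_nonneg fun n => pastMeasure_nonneg hσ h0.le h1 n ρ s (jump_nonneg hσ h0.le _ zero_le_one)

lemma totalWeight_nonneg (hσ : IsStrategy σ) (h0 : 0 < h) (h1 : h ≤ 1) (ρ : List (S × A)) :
    0 ≤ totalWeight σ h ρ := by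
  cases ρ with
  | nil => exact zero_le_one
  | cons x ρ => exact jumpWeight_nonneg hσ h0 h1 ρ _ _

lemma sum_jumpWeight (hσ : IsStrategy σ) (h0 : 0 < h) (h1 : h ≤ 1)
    (ρ : List (S × A)) (s : S) : ∑ a, jumpWeight σ h ρ s a = totalWeight σ h ρ := by
  have e1 := hasSum_sum fun a (_ : a ∈ Finset.univ) => hasSum_jumpWeight hσ h0 h1 ρ s a
  have e2 := (hasSum_pastMeasure_one hσ h0 h1 ρ s).mul_left h
  simp only [sum_pastMeasure_jump hσ] at e1
  rw [e1.unique e2, mul_div_cancel₀ _ h0.ne']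

lemma isStrategy_mimic (hσ : IsStrategy σ) (h0 : 0 < h) (h1 : h ≤ 1) :
    IsStrategy (mimic σ h) := by
  constructor
  · intro η a
    unfold mimic
    split_ifs
    · exact hσ.1 η a
    · exact div_nonneg (jumpWeight_nonneg hσ h0 h1 _ _ _) (totalWeight_nonneg hσ h0 h1 _)
  · intro η
    unfold mimic
    split_ifs with hη
    · exact hσ.2 η
    · rw [← Finset.sum_div, sum_jumpWeight hσ h0 h1, div_self hη]

lemma mimic_mul_totalWeight (hσ : IsStrategy σ) (h0 : 0 < h) (h1 : h ≤ 1)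
    (ρ : List (S × A)) (s : S) (a : A) :
    mimic σ h (ρ, s) a * totalWeight σ h ρ = jumpWeight σ h ρ s a := by
  unfold mimic
  split_ifs with hη
  · have := (Finset.sum_eq_zero_iff_of_nonneg
      fun a _ => jumpWeight_nonneg hσ h0 h1 ρ s a).1 ((sum_jumpWeight hσ h0 h1 ρ s).trans hη)
    rw [this a (Finset.mem_univ a)]
    simp [show totalWeight σ h ρ = 0 from hη]
  · exact div_mul_cancel₀ _ hη

end Mimic

namespace POMDP

variable {Ω A S : Type*}

/-- The probability of the state `ω` following a reversed past trajectory. -/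
def nextP (M : POMDP Ω A S) : List (Ω × A) → Ω → ℝ
  | [], ω => M.p1 ω
  | x :: _, ω => M.P x.1 x.2 ω

/-- The product of the state transition probabilities along a trajectory. -/
def transP (M : POMDP Ω A S) : List (Ω × A) → Ω → ℝ
  | [], ω => M.p1 ω
  | x :: b, ω => M.P x.1 x.2 ω * transP M b x.1

/-- The past signals and actions. -/
def obsPast (M : POMDP Ω A S) (b : List (Ω × A)) : List (S × A) :=
  b.map fun p => (M.f p.1, p.2)

lemma trajP_cons (M : POMDP Ω A S) (σ : Strategy S A) (x : Ω × A) (b : List (Ω × A)) :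
    trajP M σ (x :: b) = M.nextP b x.1 * σ (M.obsPast b, M.f x.1) x.2 * trajP M σ b := by
  cases b <;> rfl

lemma transP_nonneg [Fintype Ω] {M : POMDP Ω A S} (hM : M.IsValid) (b : List (Ω × A)) (ω : Ω) :
    0 ≤ M.transP b ω := by
  induction b generalizing ω with
  | nil => exact hM.2.2.1 ω
  | cons x b ih => exact mul_nonneg (hM.1 _ _ _) (ih _)

variable [Fintype A]

lemma trajP_mimic (M : POMDP Ω A S) {σ : Strategy S A} {h : ℝ} (hσ : IsStrategy σ)
    (h0 : 0 < h) (h1 : h ≤ 1) (x : Ω × A) (b : List (Ω × A)) :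
    trajP M (mimic σ h) (x :: b) =
      M.transP b x.1 * jumpWeight σ h (M.obsPast b) (M.f x.1) x.2 := by
  induction b generalizing x with
  | nil =>
    rw [trajP_cons, ← mimic_mul_totalWeight hσ h0 h1]
    simp [trajP, nextP, transP, obsPast, totalWeight]
  | cons y b ih =>
    rw [trajP_cons, ih, ← mimic_mul_totalWeight hσ h0 h1 _ (M.f x.1)]
    simp only [nextP, transP, obsPast, totalWeight, List.map_cons]
    ring

variable [Fintype Ω]

lemma stageE_eq (M : POMDP Ω A S) (σ : Strategy S A) (n : ℕ) :
    M.stageE σ n = ∑ b : Fin n → Ω × A, ∑ ω, ∑ a,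
      trajP M σ ((ω, a) :: List.ofFn b) * M.g ω a := by
  have := sum_ofFn_succ n fun l : List (Ω × A) => trajP M σ l *
    (l.head?.elim 0 fun x => M.g x.1 x.2)
  simp only [List.ofFn_succ, List.head?_cons, Option.elim_some] at this
  simp only [stageE, List.ofFn_succ, this, Fintype.sum_prod_type]

/-- The expectation of a function of the current state and of the observed past. -/
noncomputable def expect (M : POMDP Ω A S) (σ : Strategy S A) (n : ℕ)
    (φ : Ω → List (S × A) → ℝ) : ℝ :=
  ∑ b : Fin n → Ω × A, ∑ ω,
    M.nextP (List.ofFn b) ω * trajP M σ (List.ofFn b) * φ ω (M.obsPast (List.ofFn b))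

/-- The expected payoff of the current stage. -/
noncomputable def currentPayoff (M : POMDP Ω A S) (σ : Strategy S A) (ω : Ω)
    (l : List (S × A)) : ℝ :=
  ∑ a, σ (l, M.f ω) a * M.g ω a

/-- The part of the one-stage operator of the game of stage duration `h` in which the state is
redrawn. -/
noncomputable def redraw (M : POMDP Ω A S) (σ : Strategy S A) (h : ℝ)
    (φ : Ω → List (S × A) → ℝ) : Ω → List (S × A) → ℝ :=
  fun ω => ∑ a, ∑ ω', M.P ω a ω' • jump σ h (M.f ω, a) (φ ω')

/-- The part of the one-stage operator of the game of stage duration `h` in which the state is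
kept. -/
noncomputable def keep (M : POMDP Ω A S) (σ : Strategy S A) (h : ℝ)
    (φ : Ω → List (S × A) → ℝ) : Ω → List (S × A) → ℝ :=
  fun ω => stay σ h (M.f ω) (φ ω)

lemma stageE_eq_expect (M : POMDP Ω A S) (σ : Strategy S A) (n : ℕ) :
    M.stageE σ n = M.expect σ n (M.currentPayoff σ) := by
  rw [stageE_eq, expect]
  refine Finset.sum_congr rfl fun b _ => Finset.sum_congr rfl fun ω _ => ?_
  rw [currentPayoff, Finset.mul_sum]
  exact Finset.sum_congr rfl fun a _ => by rw [trajP_cons]; ring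

lemma expect_add (M : POMDP Ω A S) (σ : Strategy S A) (n : ℕ)
    (φ ψ : Ω → List (S × A) → ℝ) :
    M.expect σ n (φ + ψ) = M.expect σ n φ + M.expect σ n ψ := by
  simp only [expect, Pi.add_apply, mul_add, Finset.sum_add_distrib]

lemma expect_dur_succ [DecidableEq Ω] (M : POMDP Ω A S) (σ : Strategy S A) (h : ℝ) (n : ℕ)
    (φ : Ω → List (S × A) → ℝ) :
    (M.dur h).expect σ (n + 1) φ =
      (M.dur h).expect σ n (M.keep σ h φ + M.redraw σ h φ) := by
  rw [expect, sum_ofFn_succ n fun l : List (Ω × A) => ∑ ω,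
    (M.dur h).nextP l ω * trajP (M.dur h) σ l * φ ω ((M.dur h).obsPast l), expect]
  refine Finset.sum_congr rfl fun b _ => ?_
  rw [Fintype.sum_prod_type]
  refine Finset.sum_congr rfl fun ω _ => ?_
  have e : ∀ a l, ∑ ω', (M.dur h).P ω a ω' * φ ω' l =
      (1 - h) * φ ω l + h * ∑ ω', M.P ω a ω' * φ ω' l := by
    intro a l
    simp only [dur, add_mul, Finset.sum_add_distrib, mul_assoc, ← Finset.mul_sum]
    simp [add_comm]
  have e2 : ∀ l, (M.keep σ h φ + M.redraw σ h φ) ω l = ∑ a, σ (l, M.f ω) a *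
      ((1 - h) * φ ω ((M.f ω, a) :: l) + h * ∑ ω', M.P ω a ω' * φ ω' ((M.f ω, a) :: l)) := by
    intro l
    simp only [keep, redraw, stay, jump, Pi.add_apply, Finset.sum_apply, Pi.smul_apply,
      smul_eq_mul, LinearMap.coe_mk, AddHom.coe_mk, Finset.mul_sum, mul_add,
      Finset.sum_add_distrib]
    congr 1
    · exact Finset.sum_congr rfl fun a _ => by ring
    · exact Finset.sum_congr rfl fun a _ => Finset.sum_congr rfl fun ω' _ => by ring
  rw [e2, Finset.mul_sum]
  refine Finset.sum_congr rfl fun a _ => ?_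
  rw [← e, trajP_cons, Finset.mul_sum, Finset.mul_sum]
  refine Finset.sum_congr rfl fun ω' _ => ?_
  simp only [nextP, obsPast, List.map_cons]
  change _ * (_ * σ (_, M.f ω) a * _) * φ ω' ((M.f ω, a) :: _) = _
  ring

/-- The expectation, in the game of stage duration `h` and at stage `n + 1`, of a function of the
current state and of the observed past, on the event that the state was redrawn `k` times. -/
noncomputable def expectRedraws (M : POMDP Ω A S) (σ : Strategy S A) (h : ℝ) (n k : ℕ)
    (φ : Ω → List (S × A) → ℝ) : ℝ :=
  ∑ b : Fin k → Ω × A, ∑ ω, M.transP (List.ofFn b) ω *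
    pastMeasure σ h n (M.obsPast (List.ofFn b)) (M.f ω) (φ ω)

variable {M : POMDP Ω A S} {σ : Strategy S A} {h : ℝ}

lemma expectRedraws_zero_zero (φ : Ω → List (S × A) → ℝ) :
    M.expectRedraws σ h 0 0 φ = ∑ ω, M.p1 ω * φ ω [] := by
  simp [expectRedraws, transP, obsPast, pastMeasure]

lemma expectRedraws_zero_succ (k : ℕ) (φ : Ω → List (S × A) → ℝ) :
    M.expectRedraws σ h 0 (k + 1) φ = 0 := by
  simp [expectRedraws, obsPast, pastMeasure, List.ofFn_succ]

lemma expectRedraws_succ_zero (n : ℕ) (φ : Ω → List (S × A) → ℝ) :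
    M.expectRedraws σ h (n + 1) 0 φ = M.expectRedraws σ h n 0 (M.keep σ h φ) := by
  simp [expectRedraws, obsPast, pastMeasure, keep]

lemma expectRedraws_succ_succ (n k : ℕ) (φ : Ω → List (S × A) → ℝ) :
    M.expectRedraws σ h (n + 1) (k + 1) φ =
      M.expectRedraws σ h n (k + 1) (M.keep σ h φ) +
        M.expectRedraws σ h n k (M.redraw σ h φ) := by
  have e : ∀ b : Fin (k + 1) → Ω × A, ∑ ω, M.transP (List.ofFn b) ω *
      pastMeasure σ h (n + 1) (M.obsPast (List.ofFn b)) (M.f ω) (φ ω) =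
      ∑ ω, M.transP (List.ofFn b) ω *
        pastMeasure σ h n (M.obsPast (List.ofFn b)) (M.f ω) (M.keep σ h φ ω) +
      ∑ ω, M.transP (List.ofFn b) ω * pastMeasure σ h n (M.obsPast (List.ofFn b).tail)
        (M.f (b 0).1) (jump σ h (M.f (b 0).1, (b 0).2) (φ ω)) := by
    intro b
    rw [← Finset.sum_add_distrib]
    refine Finset.sum_congr rfl fun ω _ => ?_
    simp only [List.ofFn_succ, obsPast, List.map_cons, pastMeasure, LinearMap.add_apply,
      LinearMap.comp_apply, keep, mul_add, List.tail_cons]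
  rw [expectRedraws, Finset.sum_congr rfl fun b _ => e b, Finset.sum_add_distrib]
  congr 1
  have := sum_ofFn_succ k fun l : List (Ω × A) => l.head?.elim 0 fun x =>
    ∑ ω, M.transP l ω * pastMeasure σ h n (M.obsPast l.tail)
        (M.f x.1) (jump σ h (M.f x.1, x.2) (φ ω))
  simp only [List.ofFn_succ, List.head?_cons, Option.elim_some, List.tail_cons] at this
  simp only [List.ofFn_succ, List.tail_cons, this]
  refine Finset.sum_congr rfl fun b _ => ?_
  rw [Fintype.sum_prod_type]
  refine Finset.sum_congr rfl fun ω _ => ?_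
  simp only [redraw, map_sum, map_smul, smul_eq_mul, Finset.mul_sum, transP]
  exact Finset.sum_congr rfl fun a _ => Finset.sum_congr rfl fun ω' _ => by ring

lemma expectRedraws_eq_zero {n k : ℕ} (hk : n < k) (φ : Ω → List (S × A) → ℝ) :
    M.expectRedraws σ h n k φ = 0 := by
  induction n generalizing k φ with
  | zero =>
    cases k with
    | zero => omega
    | succ k => exact expectRedraws_zero_succ k φ
  | succ n ih =>
    cases k with
    | zero => omega
    | succ k => rw [expectRedraws_succ_succ, ih (by omega), ih (by omega), add_zero]

lemma sum_expectRedraws [DecidableEq Ω] (n : ℕ) (φ : Ω → List (S × A) → ℝ) :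
    ∑ k ∈ Finset.range (n + 1), M.expectRedraws σ h n k φ = (M.dur h).expect σ n φ := by
  induction n generalizing φ with
  | zero =>
    simp only [zero_add, Finset.sum_range_one, expectRedraws_zero_zero]
    simp [expect, nextP, trajP, obsPast, dur]
  | succ n ih =>
    rw [Finset.sum_range_succ', expectRedraws_succ_zero]
    simp only [expectRedraws_succ_succ]
    rw [Finset.sum_add_distrib, add_right_comm,
      ← Finset.sum_range_succ' (fun k => M.expectRedraws σ h n k (M.keep σ h φ)),
      Finset.sum_range_succ, expectRedraws_eq_zero (Nat.lt_succ_self n), add_zero, ih, ih,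
      ← expect_add, expect_dur_succ]

lemma expectRedraws_smul (n k : ℕ) (c : ℝ) (φ : Ω → List (S × A) → ℝ) :
    M.expectRedraws σ h n k (c • φ) = c * M.expectRedraws σ h n k φ := by
  simp only [expectRedraws, Pi.smul_apply, map_smul, smul_eq_mul, Finset.mul_sum]
  exact Finset.sum_congr rfl fun b _ => Finset.sum_congr rfl fun ω _ => by ring

lemma expectRedraws_one (hM : M.IsValid) (hσ : IsStrategy σ) (n k : ℕ) :
    M.expectRedraws σ h n k 1 = binomialWeight h n k := by
  have hkeep : M.keep σ h 1 = (1 - h) • 1 := by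
    ext1 ω
    exact stay_one hσ _
  have hredraw : M.redraw σ h 1 = h • 1 := by
    ext1 ω
    simp only [redraw, Pi.one_apply, ← Finset.sum_smul, hM.2.1, one_smul]
    exact sum_jump_one hσ _
  induction n generalizing k with
  | zero =>
    cases k with
    | zero => simp [expectRedraws_zero_zero, binomialWeight, hM.2.2.2]
    | succ k => simp [expectRedraws_zero_succ, binomialWeight]
  | succ n ih =>
    cases k with
    | zero => rw [expectRedraws_succ_zero, hkeep, expectRedraws_smul, ih, binomialWeight]
    | succ k =>
      rw [expectRedraws_succ_succ, hkeep, hredraw, expectRedraws_smul, expectRedraws_smul, ih, ih,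
        binomialWeight]

lemma abs_expectRedraws_le (hM : M.IsValid) (hσ : IsStrategy σ) (h0 : 0 ≤ h) (h1 : h ≤ 1)
    (n k : ℕ) {φ : Ω → List (S × A) → ℝ} {C : ℝ} (hφ : ∀ ω l, |φ ω l| ≤ C) :
    |M.expectRedraws σ h n k φ| ≤ C * binomialWeight h n k := by
  rw [← expectRedraws_one hM hσ, expectRedraws, expectRedraws, Finset.mul_sum]
  refine (Finset.abs_sum_le_sum_abs _ _).trans (Finset.sum_le_sum fun b _ => ?_)
  rw [Finset.mul_sum]
  refine (Finset.abs_sum_le_sum_abs _ _).trans (Finset.sum_le_sum fun ω _ => ?_)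
  rw [abs_mul, abs_of_nonneg (transP_nonneg hM _ _), mul_left_comm]
  exact mul_le_mul_of_nonneg_left (abs_pastMeasure_le hσ h0 h1 n _ _ (hφ ω))
    (transP_nonneg hM _ _)

lemma abs_currentPayoff_le (hσ : IsStrategy σ) (ω : Ω) (l : List (S × A)) :
    |M.currentPayoff σ ω l| ≤ ∑ ω, ∑ a, |M.g ω a| := by
  have hle : ∀ a, σ (l, M.f ω) a ≤ 1 := fun a => by
    rw [← hσ.2 (l, M.f ω)]
    exact Finset.single_le_sum (fun a _ => hσ.1 _ a) (Finset.mem_univ a)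
  calc _ ≤ ∑ a, |M.g ω a| := by
        refine (Finset.abs_sum_le_sum_abs _ _).trans (Finset.sum_le_sum fun a _ => ?_)
        rw [abs_mul, abs_of_nonneg (hσ.1 _ a)]
        exact mul_le_of_le_one_left (abs_nonneg _) (hle a)
    _ ≤ _ := Finset.single_le_sum (f := fun ω => ∑ a, |M.g ω a|)
        (fun ω _ => Finset.sum_nonneg fun a _ => abs_nonneg _) (Finset.mem_univ ω)

lemma hasSum_expectRedraws_currentPayoff (hσ : IsStrategy σ) (h0 : 0 < h) (h1 : h ≤ 1) (k : ℕ) :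
    HasSum (fun n => M.expectRedraws σ h n k (M.currentPayoff σ))
      (M.stageE (mimic σ h) k / h) := by
  have hpay : ∀ ω, M.currentPayoff σ ω =
      h⁻¹ • ∑ a, M.g ω a • jump σ h (M.f ω, a) 1 := by
    intro ω
    ext l
    simp only [currentPayoff, jump, Pi.smul_apply, Finset.sum_apply, smul_eq_mul,
      LinearMap.coe_mk, AddHom.coe_mk, Pi.one_apply, Finset.mul_sum]
    exact Finset.sum_congr rfl fun a _ => by field_simp
  rw [stageE_eq, div_eq_inv_mul, Finset.mul_sum]
  refine hasSum_sum fun b _ => ?_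
  rw [Finset.mul_sum]
  refine hasSum_sum fun ω _ => ?_
  simp only [hpay, map_smul, map_sum, smul_eq_mul, trajP_mimic M hσ h0 h1]
  have := ((hasSum_sum fun a (_ : a ∈ Finset.univ) =>
    (hasSum_jumpWeight hσ h0 h1 (M.obsPast (List.ofFn b)) (M.f ω) a).mul_left
      (M.g ω a)).mul_left h⁻¹).mul_left (M.transP (List.ofFn b) ω)
  refine (congrArg (HasSum _) ?_).mp this
  simp only [Finset.mul_sum]
  exact Finset.sum_congr rfl fun a _ => by ring

end POMDP

/-- Any strategy `σ` in `G_h`, `h ∈ (0,1)`, can be mimicked by a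
strategy `σ'` in the base POMDP `G₁` with the same expected long-run average payoff. -/
theorem mimic_in_base {Ω A S : Type*} [Fintype Ω] [Fintype A] [DecidableEq Ω]
    (M : POMDP Ω A S) (hM : M.IsValid) (h : ℝ) (hh : h ∈ Set.Ioo (0 : ℝ) 1)
    (σ : Strategy S A) (hσ : IsStrategy σ) :
    ∃ σ' : Strategy S A, IsStrategy σ' ∧ (M.dur h).R σ = M.R σ' := by
  refine ⟨mimic σ h, isStrategy_mimic hσ hh.1 hh.2.le, ?_⟩
  have := liminf_average_rows_eq hh.1 hh.2
    (fun n k => POMDP.abs_expectRedraws_le hM hσ hh.1.le hh.2.le n k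
      (POMDP.abs_currentPayoff_le (M := M) hσ))
    (POMDP.hasSum_expectRedraws_currentPayoff (M := M) hσ hh.1 hh.2.le)
  rw [POMDP.R, POMDP.R, ← this]
  have hstage : ∀ n, ∑ k ∈ Finset.range (n + 1),
      M.expectRedraws σ h n k (M.currentPayoff σ) = (M.dur h).stageE σ n := fun n =>
    (POMDP.sum_expectRedraws n _).trans (POMDP.stageE_eq_expect _ σ n).symm
  simp only [hstage]
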